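/- The set of ≈-equivalence classes of irreducible words over the alphabet {s_1, …, s_{n-1}} with respect to the rewriting system 𝔖 is finite and has exactly n! elements. -/

import Mathlib

/-!
Fix `n ≥ 1`; we write `n = m + 1` where `m : ℕ`, so that words are lists over the
alphabet `{s_1, …, s_{n-1}}`, formalized as `List (Fin m)`: the letter `i : Fin m`
denotes the adjacent transposition `(i, i+1)` of `Fin (m+1)`.
-/

/-- Words over the alphabet `{s_1, …, s_{n-1}}` with `n = m + 1`. -/
abbrev Word (m : ℕ) := List (Fin m)

/-- The letter `s_i` as the adjacent transposition `(i, i+1)` of `{1, …, n}`. -/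
def toSwap {m : ℕ} (i : Fin m) : Equiv.Perm (Fin (m + 1)) :=
  Equiv.swap i.castSucc i.succ

/-- Evaluation of a word: the composite of the transpositions taken in the order
in which they occur in the word (the leftmost letter is applied first). -/
def eval {m : ℕ} (w : Word m) : Equiv.Perm (Fin (m + 1)) :=
  (w.map toSwap).reverse.prod

/-- The interchange equivalence `≈`: the smallest congruence on words (compatible
with concatenation) generated by `s_i s_j ≈ s_j s_i` whenever `|i - j| ≥ 2`. -/
inductive Interchange {m : ℕ} : Word m → Word m → Prop
  | swap (u v : Word m) (i j : Fin m)
      (h : (i : ℕ) + 2 ≤ (j : ℕ) ∨ (j : ℕ) + 2 ≤ (i : ℕ)) :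
      Interchange (u ++ [i, j] ++ v) (u ++ [j, i] ++ v)
  | refl (w : Word m) : Interchange w w
  | symm {w w' : Word m} : Interchange w w' → Interchange w' w
  | trans {w₁ w₂ w₃ : Word m} :
      Interchange w₁ w₂ → Interchange w₂ w₃ → Interchange w₁ w₃

/-- The rules of the rewriting system `𝔖`:
`s_i s_i ⇒ ε` and `s_i s_{i+1} s_i ⇒ s_{i+1} s_i s_{i+1}`. -/
inductive Rule {m : ℕ} : Word m → Word m → Prop
  | del (i : Fin m) : Rule [i, i] []
  | yb (i j : Fin m) (h : (j : ℕ) = (i : ℕ) + 1) : Rule [i, j, i] [j, i, j]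

/-- One rewriting step of `𝔖`, applied inside an arbitrary context and modulo `≈`:
`w ⇒ w'` iff `w ≈ u·l·v` and `w' ≈ u·r·v` for some rule `l ⇒ r` and words `u, v`. -/
def Step {m : ℕ} (w w' : Word m) : Prop :=
  ∃ u v l r, Rule l r ∧ Interchange w (u ++ l ++ v) ∧ Interchange w' (u ++ r ++ v)

/-- A word is irreducible if no word `≈`-equivalent to it contains the left-hand
side of a rule as a factor. -/
def IrreducibleWord {m : ℕ} (w : Word m) : Prop :=
  ∀ u v l r : Word m, Rule l r → ¬ Interchange w (u ++ l ++ v)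

/-- The setoid of irreducible words up to the interchange equivalence `≈`. -/
def irrSetoid (m : ℕ) : Setoid {w : Word m // IrreducibleWord w} where
  r a b := Interchange a.1 b.1
  iseqv := ⟨fun a => Interchange.refl a.1, Interchange.symm, Interchange.trans⟩

namespace Interchange

variable {m : ℕ} {u v w : Word m}

theorem append_context (h : Interchange u v) (a b : Word m) :
    Interchange (a ++ u ++ b) (a ++ v ++ b) := by
  induction h with
  | swap c d i j hij => simpa using Interchange.swap (a ++ c) (d ++ b) i j hij
  | refl w => exact .refl _
  | symm _ ih => exact ih.symm
  | trans _ _ ih₁ ih₂ => exact ih₁.trans ih₂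

theorem append_right (h : Interchange u v) (b : Word m) : Interchange (u ++ b) (v ++ b) := by
  simpa using h.append_context [] b

theorem perm (h : Interchange u v) : u.Perm v := by
  induction h with
  | swap c d i j _ => exact ((List.Perm.swap j i []).append_left c).append_right d
  | refl w => exact .refl _
  | symm _ ih => exact ih.symm
  | trans _ _ ih₁ ih₂ => exact ih₁.trans ih₂

/-- A letter commutes with any word all of whose letters are far from it. -/
theorem append_singleton (x : Fin m)
    (h : ∀ y ∈ w, (y : ℕ) + 2 ≤ x ∨ (x : ℕ) + 2 ≤ y) : Interchange (w ++ [x]) (x :: w) := by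
  induction w with
  | nil => exact .refl _
  | cons y w ih =>
    have h₁ := (ih fun z hz => h z (List.mem_cons_of_mem _ hz)).append_context [y] []
    have h₂ := Interchange.swap [] w y x (h y List.mem_cons_self)
    exact (by simpa using h₁ : Interchange (y :: w ++ [x]) (y :: x :: w)).trans (by simpa using h₂)

end Interchange

theorem eval_append {m : ℕ} (u v : Word m) : eval (u ++ v) = eval v * eval u := by
  simp [eval]

theorem toSwap_mul_self {m : ℕ} (i : Fin m) : toSwap i * toSwap i = 1 :=
  Equiv.swap_mul_self _ _

theorem toSwap_comm {m : ℕ} {i j : Fin m} (h : (i : ℕ) + 2 ≤ j ∨ (j : ℕ) + 2 ≤ i) :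
    toSwap i * toSwap j = toSwap j * toSwap i := by
  have hd : (toSwap i).Disjoint (toSwap j) := by
    intro x
    by_cases hx : x = i.castSucc ∨ x = i.succ
    · right
      apply Equiv.swap_apply_of_ne_of_ne <;> rcases hx with rfl | rfl <;>
        simp only [ne_eq, Fin.ext_iff, Fin.val_castSucc, Fin.val_succ] <;> omega
    · left
      push Not at hx
      exact Equiv.swap_apply_of_ne_of_ne hx.1 hx.2
  exact hd.commute

theorem toSwap_braid {m : ℕ} {i j : Fin m} (h : (j : ℕ) = i + 1) :
    toSwap i * toSwap j * toSwap i = toSwap j * toSwap i * toSwap j := by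
  have e : j.castSucc = i.succ := by simp [Fin.ext_iff, h]
  have h₁ : i.castSucc ≠ i.succ := by simp [Fin.ext_iff]
  have h₂ : i.castSucc ≠ j.succ := by
    simp only [ne_eq, Fin.ext_iff, Fin.val_castSucc, Fin.val_succ]
    omega
  have h₃ : i.succ ≠ j.succ := by
    simp only [ne_eq, Fin.ext_iff, Fin.val_succ]
    omega
  simp only [toSwap, e]
  rw [Equiv.swap_mul_swap_mul_swap h₁ h₂, Equiv.swap_comm i.castSucc i.succ,
    Equiv.swap_comm i.succ j.succ, Equiv.swap_mul_swap_mul_swap h₃.symm h₂.symm, Equiv.swap_comm]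

theorem Interchange.eval_eq {m : ℕ} {u v : Word m} (h : Interchange u v) : eval u = eval v := by
  induction h with
  | swap a b i j hij =>
    have : eval [i, j] = eval [j, i] := by simpa [eval] using (toSwap_comm hij).symm
    simp only [eval_append, this]
  | refl w => rfl
  | symm _ ih => exact ih.symm
  | trans _ _ ih₁ ih₂ => exact ih₁.trans ih₂

theorem Rule.eval_eq {m : ℕ} {l r : Word m} (h : Rule l r) : eval l = eval r := by
  cases h with
  | del i => simp [eval, toSwap_mul_self]
  | yb i j hij => simpa [eval, mul_assoc] using toSwap_braid hij

/-- A weight on words that is invariant under interchange and decreased by every rule. -/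
def weight {m : ℕ} (w : Word m) : ℕ := (w.map fun i : Fin m => m - (i : ℕ)).sum

theorem weight_append {m : ℕ} (u v : Word m) : weight (u ++ v) = weight u + weight v := by
  simp [weight]

theorem Rule.weight_lt {m : ℕ} {l r : Word m} (h : Rule l r) : weight r < weight l := by
  cases h with
  | del i => simp [weight]
  | yb i j hij =>
    simp only [weight, List.map_cons, List.map_nil, List.sum_cons, List.sum_nil]
    omega

theorem Interchange.weight_eq {m : ℕ} {u v : Word m} (h : Interchange u v) :
    weight u = weight v := (h.perm.map _).sum_eq

theorem exists_irreducible_eval_eq {m : ℕ} (w : Word m) :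
    ∃ v : Word m, IrreducibleWord v ∧ eval v = eval w := by
  induction hn : weight w using Nat.strong_induction_on generalizing w with
  | _ n ih =>
    by_cases hw : IrreducibleWord w
    · exact ⟨w, hw, rfl⟩
    · simp only [IrreducibleWord, not_forall, not_not] at hw
      obtain ⟨a, b, l, r, hr, hI⟩ := hw
      have hlt : weight (a ++ r ++ b) < n := by
        have := hr.weight_lt
        rw [← hn, hI.weight_eq]
        simp only [weight_append]
        omega
      obtain ⟨v, hv, he⟩ := ih _ hlt _ rfl
      exact ⟨v, hv, by rw [he, hI.eval_eq]; simp only [eval_append, hr.eval_eq]⟩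

theorem eval_surjective (m : ℕ) : Function.Surjective (eval : Word m → _) := by
  intro σ
  have hσ : σ ∈ Submonoid.closure
      (Set.range fun i : Fin m => Equiv.swap i.castSucc i.succ) := by
    rw [Equiv.Perm.mclosure_swap_castSucc_succ]; trivial
  induction hσ using Submonoid.closure_induction with
  | mem x hx =>
    obtain ⟨i, rfl⟩ := hx
    exact ⟨[i], by simp [eval, toSwap]⟩
  | one => exact ⟨[], by simp [eval]⟩
  | mul x y _ _ hx hy =>
    obtain ⟨a, rfl⟩ := hx
    obtain ⟨b, rfl⟩ := hy
    exact ⟨b ++ a, eval_append b a⟩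

theorem IrreducibleWord.of_interchange {m : ℕ} {u v : Word m} (hu : IrreducibleWord u)
    (h : Interchange u v) : IrreducibleWord v :=
  fun a b l r hr hI => hu a b l r hr (h.trans hI)

theorem IrreducibleWord.of_append {m : ℕ} {u v : Word m} (h : IrreducibleWord (u ++ v)) :
    IrreducibleWord u := fun a b l r hr hI =>
  h a (b ++ v) l r hr (by simpa using hI.append_right v)

/-- The word `s_k s_{k+1} ⋯ s_{k+t-1}`, cut off at the last letter of the alphabet. -/
def ramp (m k : ℕ) : ℕ → Word m
  | 0 => []
  | t + 1 => ramp m k t ++ if h : k + t < m then [⟨k + t, h⟩] else []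

theorem ramp_succ {m k t : ℕ} (h : k + t < m) :
    ramp m k (t + 1) = ramp m k t ++ [⟨k + t, h⟩] := by
  simp [ramp, h]

theorem lt_of_mem_ramp {m k t : ℕ} {x : Fin m} (hx : x ∈ ramp m k t) : (x : ℕ) < k + t := by
  induction t with
  | zero => simp [ramp] at hx
  | succ t ih =>
    rw [ramp, List.mem_append] at hx
    rcases hx with hx | hx
    · have := ih hx
      omega
    · split_ifs at hx with h
      · rw [List.mem_singleton.1 hx]
        exact Nat.lt_succ_self _
      · simp at hx

theorem exists_lhs_of_ramp_append {m k t : ℕ} (ht : k + t ≤ m) {x : Fin m} (hk : k ≤ (x : ℕ))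
    (hx : (x : ℕ) < k + t) :
    ∃ u v l r : Word m, Rule l r ∧ Interchange (ramp m k t ++ [x]) (u ++ l ++ v) := by
  induction t with
  | zero => omega
  | succ t ih =>
    have hlt : k + t < m := by omega
    rw [ramp_succ hlt]
    rcases lt_trichotomy ((x : ℕ) + 1) (k + t) with h | h | h
    · obtain ⟨u, v, l, r, hr, hI⟩ := ih hlt.le (by omega)
      refine ⟨u, v ++ [⟨k + t, hlt⟩], l, r, hr, ?_⟩
      have h₁ := Interchange.swap (ramp m k t) [] (⟨k + t, hlt⟩ : Fin m) x (Or.inr h)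
      have h₂ := hI.append_right [⟨k + t, hlt⟩]
      simp only [List.append_assoc, List.cons_append, List.nil_append, List.append_nil] at h₁ h₂ ⊢
      exact h₁.trans h₂
    · obtain ⟨s, rfl⟩ : ∃ s, t = s + 1 := ⟨t - 1, by omega⟩
      have hs : k + s < m := by omega
      have hxs : x = ⟨k + s, hs⟩ := Fin.ext (by simp only; omega)
      refine ⟨ramp m k s, [], _, _, Rule.yb x ⟨k + (s + 1), hlt⟩ (by simp only; omega), ?_⟩
      rw [ramp_succ hs, hxs]
      simpa using Interchange.refl _
    · have hxt : x = ⟨k + t, hlt⟩ := Fin.ext (by simp only; omega)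
      refine ⟨ramp m k t, [], _, _, Rule.del x, ?_⟩
      rw [hxt]
      simpa using Interchange.refl _

/-- An irreducible word over the letters `≥ k` splits, up to interchange, into a word over the
letters `> k` followed by a ramp starting at `k`. -/
theorem IrreducibleWord.exists_append_ramp {m k : ℕ} {w : Word m} (hkm : k ≤ m)
    (hw : IrreducibleWord w) (hk : ∀ x ∈ w, k ≤ (x : ℕ)) :
    ∃ (a : Word m) (t : ℕ), k + t ≤ m ∧ (∀ x ∈ a, k + 1 ≤ (x : ℕ)) ∧
      Interchange w (a ++ ramp m k t) := by
  induction w using List.reverseRecOn with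
  | nil => exact ⟨[], 0, hkm, by simp, .refl _⟩
  | append_singleton w x ih =>
    obtain ⟨a, t, ht, ha, hI⟩ := ih hw.of_append fun y hy => hk y (List.mem_append_left _ hy)
    have hx : k ≤ (x : ℕ) := hk x (by simp)
    have hI' : Interchange (w ++ [x]) (a ++ (ramp m k t ++ [x])) := by
      simpa using hI.append_right [x]
    rcases lt_trichotomy (x : ℕ) (k + t) with h | h | h
    · obtain ⟨u, v, l, r, hr, hJ⟩ := exists_lhs_of_ramp_append ht hx h
      refine absurd (hI'.trans ?_) (hw (a ++ u) v l r hr)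
      simpa using hJ.append_context a []
    · have hlt : k + t < m := h ▸ x.isLt
      refine ⟨a, t + 1, hlt, ha, ?_⟩
      rw [ramp_succ hlt]
      convert hI' using 4
      exact Fin.ext h.symm
    · refine ⟨a ++ [x], t, ht, ?_, hI'.trans ?_⟩
      · intro y hy
        rcases List.mem_append.1 hy with hy | hy
        · exact ha y hy
        · rw [List.mem_singleton.1 hy]
          omega
      · have hc := Interchange.append_singleton (w := ramp m k t) x fun y hy => by
          have := lt_of_mem_ramp hy
          omega
        simpa using hc.append_context a []

/-- Canonical words over the last `d` letters. -/
def canonicalWords (m : ℕ) : ℕ → Finset (Word m)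
  | 0 => {[]}
  | d + 1 => (canonicalWords m d ×ˢ Finset.range (d + 2)).image
      fun p => p.1 ++ ramp m (m - (d + 1)) p.2

theorem card_canonicalWords_le (m d : ℕ) : (canonicalWords m d).card ≤ (d + 1).factorial := by
  induction d with
  | zero => simp [canonicalWords]
  | succ d ih =>
    refine Finset.card_image_le.trans ?_
    rw [Finset.card_product, Finset.card_range, Nat.factorial_succ (d + 1), mul_comm]
    exact Nat.mul_le_mul_left _ ih

theorem IrreducibleWord.exists_canonical {m d : ℕ} {w : Word m} (hd : d ≤ m)
    (hw : IrreducibleWord w) (hk : ∀ x ∈ w, m - d ≤ (x : ℕ)) :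
    ∃ v ∈ canonicalWords m d, Interchange w v := by
  induction d generalizing w with
  | zero =>
    have : w = [] := List.eq_nil_iff_forall_not_mem.2 fun x hx => by
      have := hk x hx
      omega
    exact ⟨[], by simp [canonicalWords], this ▸ .refl _⟩
  | succ d ih =>
    obtain ⟨a, t, ht, ha, hI⟩ := hw.exists_append_ramp (Nat.sub_le _ _) hk
    obtain ⟨v, hv, hJ⟩ := ih (by omega) (hw.of_interchange hI).of_append fun x hx => by
      have := ha x hx
      omega
    refine ⟨v ++ ramp m (m - (d + 1)) t, ?_, hI.trans (hJ.append_right _)⟩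
    exact Finset.mem_image.2 ⟨(v, t),
      Finset.mem_product.2 ⟨hv, Finset.mem_range.2 (by simp only; omega)⟩, rfl⟩

/-- The set of `≈`-equivalence classes of irreducible words over
the alphabet `{s_1, …, s_{n-1}}` is finite and has exactly `n!` elements
(here `n = m + 1`). -/
theorem card_irreducible_classes (m : ℕ) :
    Finite (Quotient (irrSetoid m)) ∧
      Nat.card (Quotient (irrSetoid m)) = Nat.factorial (m + 1) := by
  have hcan (q : Quotient (irrSetoid m)) :
      ∃ v : canonicalWords m m, Interchange q.out.1 v.1 := by
    obtain ⟨v, hv, hI⟩ := q.out.2.exists_canonical le_rfl (by simp)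
    exact ⟨⟨v, hv⟩, hI⟩
  choose f hf using hcan
  have hinj : Function.Injective f := fun p q h => by
    rw [← p.out_eq, ← q.out_eq]
    exact Quotient.sound ((hf p).trans (h ▸ (hf q).symm))
  have hfin : Finite (Quotient (irrSetoid m)) := Finite.of_injective f hinj
  refine ⟨hfin, le_antisymm ?_ ?_⟩
  · refine (Nat.card_le_card_of_injective f hinj).trans ?_
    simpa using card_canonicalWords_le m m
  · let g : Quotient (irrSetoid m) → Equiv.Perm (Fin (m + 1)) :=
      Quotient.lift (fun w => eval w.1) fun _ _ h => Interchange.eval_eq h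
    have hg : Function.Surjective g := fun σ => by
      obtain ⟨w, rfl⟩ := eval_surjective m σ
      obtain ⟨v, hv, he⟩ := exists_irreducible_eval_eq w
      exact ⟨Quotient.mk _ ⟨v, hv⟩, he⟩
    simpa [Nat.card_eq_fintype_card, Fintype.card_perm] using Nat.card_le_card_of_surjective g hg
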